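/- arXiv:2412.04801 — 4 statements merged into one kernel-verified Lean document; each statement's English description precedes it below -/
import Mathlib

section
/- Let ℓ ≥ 1 be an integer and let f_1(x), …, f_ℓ(x) be integer-valued polynomials of degree ≥ 2 with positive leading coefficients such that deg f_1(x) ≤ deg f_j(x) for all j = 1, …, ℓ. Assume there exists an integer A such that f_1(x + A) is not identically equal to f_j(Bx + C) + D for any integer j with 2 ≤ j ≤ ℓ, any integers C, D, and any positive rational number B. Let E be an arbitrary positive integer and let G(x) be any real-valued function defined for x ≥ 1 with G(x) = o(x) and G(x) → ∞ as x → ∞. Then there exist infinitely many positive integers m with m ≡ A (mod E) such that |f_1(m) − f_j(k)| > G(m) for all integers j with 1 ≤ j ≤ ℓ and all positive integers k with (j, k) ≠ (1, m). -/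
open Polynomial Filter

/-- An integer-valued polynomial: `f(n) ∈ ℤ` for every positive integer `n`. -/
def IsIntegerValued (f : Polynomial ℚ) : Prop :=
  ∀ n : ℕ, 0 < n → ∃ m : ℤ, f.eval (n : ℚ) = (m : ℚ)

/-- `f(x + A)` is not identically equal to `g(Bx + C) + D` for any positive rational `B`
and integers `C`, `D`. -/
def NonEquivAt (f g : Polynomial ℚ) (A : ℤ) : Prop :=
  ∀ B : ℚ, 0 < B → ∀ C D : ℤ,
    f.comp (X + Polynomial.C (A : ℚ)) ≠
      g.comp (Polynomial.C B * X + Polynomial.C (C : ℚ)) + Polynomial.C (D : ℚ)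


open Asymptotics

theorem lemA (G : ℝ → ℝ) (hG : G =o[atTop] fun x : ℝ => x) (P : ℝ[X])
    (hd : 1 ≤ P.natDegree) (hl : 0 < P.leadingCoeff) (c : ℝ) :
    ∀ᶠ x in atTop, c + G x < P.eval x := by
  have hdeg : (0 : WithBot ℕ) < P.degree := natDegree_pos_iff_degree_pos.mp hd
  have ht : Tendsto (fun x => P.eval x) atTop atTop :=
    P.tendsto_atTop_of_leadingCoeff_nonneg hdeg hl.le
  have hO : (fun x : ℝ => x) =O[atTop] (fun x => P.eval x) := by
    have := Polynomial.isBigO_atTop_of_degree_le (X : ℝ[X]) P (by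
      rw [degree_X]; rw [degree_eq_natDegree (by rintro rfl; simp at hd)]; exact_mod_cast hd)
    simpa using this
  have ho := hG.trans_isBigO hO
  have h1 := ho.bound (show (0:ℝ) < 1/2 by norm_num)
  filter_upwards [h1, ht.eventually_gt_atTop (2 * |c|), ht.eventually_gt_atTop 0] with x h1 h2 h3
  rw [Real.norm_eq_abs, Real.norm_eq_abs, abs_of_pos h3] at h1
  have := le_abs_self (G x)
  have := le_abs_self c
  linarith

theorem lemU (P : ℝ[X]) (n : ℕ) (h : P.natDegree ≤ n) :
    ∃ c > 0, ∀ᶠ x : ℝ in atTop, P.eval x ≤ c * x ^ n := by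
  have := Polynomial.isBigO_atTop_of_degree_le P (X ^ n) (by
    rw [degree_X_pow]; exact natDegree_le_iff_degree_le.mp h)
  obtain ⟨c, hc, h⟩ := this.exists_pos
  refine ⟨c, hc, ?_⟩
  filter_upwards [h.bound, eventually_ge_atTop 0] with x hx h0
  simp only [eval_pow, eval_X, Real.norm_eq_abs, abs_pow, abs_of_nonneg h0] at hx
  exact (le_abs_self _).trans hx

theorem lemL (G : ℝ → ℝ) (hG : G =o[atTop] fun x : ℝ => x) (P : ℝ[X])
    (hd : 1 ≤ P.natDegree) (hl : 0 < P.leadingCoeff) :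
    ∃ c > 0, ∀ᶠ x : ℝ in atTop, c * x ^ P.natDegree + G x ≤ P.eval x := by
  refine ⟨P.leadingCoeff / 2, by positivity, ?_⟩
  set Q := P - C (P.leadingCoeff / 2) * X ^ P.natDegree with hQ
  have hc : Q.coeff P.natDegree = P.leadingCoeff / 2 := by
    simp only [hQ, coeff_sub, coeff_C_mul, coeff_X_pow_self, coeff_natDegree]; ring
  have hn : Q.natDegree = P.natDegree := by
    apply natDegree_eq_of_le_of_coeff_ne_zero
    · exact (natDegree_sub_le _ _).trans (max_le le_rfl (natDegree_C_mul_X_pow_le _ _))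
    · rw [hc]; positivity
  have hQl : 0 < Q.leadingCoeff := by
    rw [leadingCoeff, hn, hc]; positivity
  filter_upwards [lemA G hG Q (hn ▸ hd) hQl 0] with x hx
  simp only [hQ, eval_sub, eval_mul, eval_C, eval_pow, eval_X] at hx
  linarith

theorem lemMono (g : ℝ[X]) (hd : 2 ≤ g.natDegree) (hl : 0 < g.leadingCoeff) :
    ∃ K : ℝ, StrictMonoOn (fun x => g.eval x) (Set.Ici K) := by
  have hn : g.derivative.natDegree = g.natDegree - 1 := natDegree_derivative g
  have hlc : 0 < g.derivative.leadingCoeff := by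
    rw [leadingCoeff, hn, coeff_derivative, Nat.sub_add_cancel (by omega)]
    rw [coeff_natDegree]; positivity
  have h := lemA (fun _ => 0) (isLittleO_zero _ _) g.derivative (by omega) hlc 0
  obtain ⟨K, hK⟩ := eventually_atTop.mp h
  refine ⟨K, strictMonoOn_of_deriv_pos (convex_Ici K) g.continuous.continuousOn ?_⟩
  intro x hx
  rw [interior_Ici] at hx
  rw [Polynomial.deriv]
  simpa using hK x (le_of_lt hx)

theorem lemLarge (G : ℝ → ℝ) (hG : G =o[atTop] fun x : ℝ => x) (F g : ℝ[X])
    (hd : 1 ≤ F.natDegree) (hl : 0 < F.leadingCoeff) (K : ℝ) :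
    ∀ᶠ m : ℕ in atTop, ∀ k : ℕ, |F.eval (m:ℝ) - g.eval (k:ℝ)| ≤ G m → K ≤ k := by
  have : ∀ k ∈ Finset.range (⌈K⌉₊), ∀ᶠ m : ℕ in atTop, g.eval (k:ℝ) + G m < F.eval (m:ℝ) := by
    intro k _
    exact tendsto_natCast_atTop_atTop.eventually (lemA G hG F hd hl (g.eval (k:ℝ)))
  filter_upwards [(Filter.eventually_all_finset _).mpr this] with m hm k hk
  by_contra hlt
  have h1 := hm k (Finset.mem_range.mpr (Nat.lt_ceil.mpr (not_le.mp hlt)))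
  have := le_abs_self (F.eval (m:ℝ) - g.eval (k:ℝ))
  linarith

theorem taylorCoeff (H : ℝ[X]) (n : ℕ) (hH : H.natDegree = n + 1) (t : ℝ) :
    (taylor t H).coeff n = H.coeff n + (n + 1) * H.leadingCoeff * t := by
  rw [taylor_coeff]
  have hdeg : (hasseDeriv n H).natDegree ≤ 1 := by
    refine (natDegree_hasseDeriv_le H n).trans (by omega)
  rw [eval_eq_sum_range' (Nat.lt_succ_of_le hdeg)]
  simp only [Finset.sum_range_succ, Finset.sum_range_zero, hasseDeriv_coeff]
  rw [leadingCoeff, hH, add_comm 1 n]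
  simp [Nat.choose_succ_self_right]

theorem taylorDeg (F H : ℝ[X]) (n : ℕ) (hF : F.natDegree = n + 1) (hH : H.natDegree = n + 1)
    (hl : F.leadingCoeff = H.leadingCoeff) (t : ℝ) : (taylor t H - F).natDegree ≤ n := by
  rw [natDegree_le_iff_coeff_eq_zero]
  intro N hN
  rw [coeff_sub]
  rcases Nat.lt_or_ge (n+1) N with h | h
  · rw [coeff_eq_zero_of_natDegree_lt (by rw [natDegree_taylor]; omega),
      coeff_eq_zero_of_natDegree_lt (by omega), sub_zero]
  · obtain rfl : N = n + 1 := by omega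
    have h1 : (taylor t H).coeff (n+1) = H.leadingCoeff := by
      have := coeff_taylor_natDegree t H
      rwa [hH] at this
    rw [h1, ← hl, leadingCoeff, hF, sub_self]

theorem taylorPos (F H : ℝ[X]) (n : ℕ) (hF : F.natDegree = n + 1) (hH : H.natDegree = n + 1)
    (hl : F.leadingCoeff = H.leadingCoeff) (t : ℝ)
    (h : F.coeff n < H.coeff n + (n + 1) * H.leadingCoeff * t) :
    (taylor t H - F).natDegree = n ∧ 0 < (taylor t H - F).leadingCoeff := by
  have hc : 0 < (taylor t H - F).coeff n := by
    rw [coeff_sub, taylorCoeff H n hH]; linarith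
  have hn := natDegree_eq_of_le_of_coeff_ne_zero (taylorDeg F H n hF hH hl t) hc.ne'
  exact ⟨hn, by rwa [leadingCoeff, hn]⟩

theorem taylorNeg (F H : ℝ[X]) (n : ℕ) (hF : F.natDegree = n + 1) (hH : H.natDegree = n + 1)
    (hl : F.leadingCoeff = H.leadingCoeff) (t : ℝ)
    (h : H.coeff n + (n + 1) * H.leadingCoeff * t < F.coeff n) :
    (F - taylor t H).natDegree = n ∧ 0 < (F - taylor t H).leadingCoeff := by
  have hc : 0 < (F - taylor t H).coeff n := by
    rw [coeff_sub, taylorCoeff H n hH]; linarith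
  have hd : (F - taylor t H).natDegree ≤ n := by
    rw [← natDegree_neg, neg_sub]; exact taylorDeg F H n hF hH hl t
  have hn := natDegree_eq_of_le_of_coeff_ne_zero hd hc.ne'
  exact ⟨hn, by rwa [leadingCoeff, hn]⟩

theorem lemSelf (G : ℝ → ℝ) (hG : G =o[atTop] fun x : ℝ => x) (F : ℝ[X])
    (hd : 2 ≤ F.natDegree) (hl : 0 < F.leadingCoeff) :
    ∀ᶠ m : ℕ in atTop, ∀ k : ℕ, k ≠ m → G m < |F.eval (m:ℝ) - F.eval (k:ℝ)| := by
  obtain ⟨n, hn⟩ : ∃ n, F.natDegree = n + 1 := ⟨F.natDegree - 1, by omega⟩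
  obtain ⟨K, hK⟩ := lemMono F hd hl
  obtain ⟨a1, a2⟩ := taylorPos F F n hn hn rfl 1 (by have : 0 < ((n:ℝ)+1) * F.leadingCoeff := by positivity
                                                     linarith)
  obtain ⟨b1, b2⟩ := taylorNeg F F n hn hn rfl (-1) (by have : 0 < ((n:ℝ)+1) * F.leadingCoeff := by positivity
                                                        linarith)
  filter_upwards [lemLarge G hG F F (by omega) hl K,
    tendsto_natCast_atTop_atTop.eventually (lemA G hG _ (by omega) a2 0),
    tendsto_natCast_atTop_atTop.eventually (lemA G hG _ (by omega) b2 0),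
    tendsto_natCast_atTop_atTop.eventually (eventually_ge_atTop K)] with m h1 h2 h3 h4 k hk
  by_contra hlt
  push Not at hlt
  have hkK := h1 k hlt
  simp only [eval_sub, taylor_eval] at h2 h3
  have hab := abs_le.mp hlt
  rcases lt_or_gt_of_ne hk with h | h
  · have h5 : ((k:ℝ)) ≤ m + -1 := by
      have : ((k + 1 : ℕ):ℝ) ≤ m := by exact_mod_cast h
      push_cast at this; linarith
    have := hK.monotoneOn (Set.mem_Ici.mpr hkK) (Set.mem_Ici.mpr (hkK.trans h5)) h5
    linarith
  · have h5 : (m:ℝ) + 1 ≤ k := by exact_mod_cast h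
    have := hK.monotoneOn (Set.mem_Ici.mpr (by linarith)) (Set.mem_Ici.mpr hkK) h5
    linarith

theorem lemBig (G : ℝ → ℝ) (hG : G =o[atTop] fun x : ℝ => x) (F g : ℝ[X])
    (hd : 2 ≤ F.natDegree) (hl : 0 < F.leadingCoeff) (hgl : 0 < g.leadingCoeff)
    (hlt : F.natDegree < g.natDegree) (h : ℕ) (hh : 0 < h) :
    ∀ᶠ m : ℕ in atTop, ∀ k k' : ℕ, |F.eval (m:ℝ) - g.eval (k:ℝ)| ≤ G m →
      |F.eval ((m + h : ℕ):ℝ) - g.eval (k':ℝ)| ≤ G (m + h : ℕ) → False := by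
  obtain ⟨n, hn⟩ : ∃ n, F.natDegree = n + 1 := ⟨F.natDegree - 1, by omega⟩
  obtain ⟨r, hr⟩ : ∃ r, g.natDegree = r + 1 := ⟨g.natDegree - 1, by omega⟩
  obtain ⟨K, hK⟩ := lemMono g (by omega) hgl
  have hh' : (0:ℝ) < h := by exact_mod_cast hh
  have hG' : (fun x => G x + G (x + h)) =o[atTop] fun x : ℝ => x := by
    refine hG.add ?_
    have h1 : (fun x => G (x + h)) =o[atTop] (fun x : ℝ => x + h) :=
      hG.comp_tendsto (tendsto_atTop_add_const_right _ _ tendsto_id)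
    refine h1.trans_isBigO ?_
    refine IsBigO.of_bound 2 ?_
    filter_upwards [eventually_ge_atTop (h:ℝ)] with x hx
    rw [Real.norm_eq_abs, Real.norm_eq_abs, abs_of_nonneg (by linarith), abs_of_nonneg (by linarith)]
    linarith
  obtain ⟨a1, a2⟩ := taylorPos F F n hn hn rfl h (by
    have : 0 < ((n:ℝ)+1) * F.leadingCoeff * h := by positivity
    linarith)
  obtain ⟨b1, b2⟩ := taylorPos g g r hr hr rfl 1 (by
    have : 0 < ((r:ℝ)+1) * g.leadingCoeff := by positivity
    linarith)
  obtain ⟨c1, hc1, e1⟩ := lemL G hG F (by omega) hl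
  obtain ⟨c2, hc2, e2⟩ := lemU g (r+1) (by omega)
  obtain ⟨c3, hc3, e3⟩ := lemL (fun _ => 0) (isLittleO_zero _ _) _ (by omega) b2
  obtain ⟨c4, hc4, e4⟩ := lemU _ n a1.le
  have e5 := lemA _ hG' _ (by omega) a2 0
  rw [b1] at e3
  rw [hn] at e1
  obtain ⟨K2, hK2⟩ := eventually_atTop.mp e2
  obtain ⟨K3, hK3⟩ := eventually_atTop.mp e3
  set L := max K (max K2 (max K3 0))
  have l1 := lemLarge G hG F g (by omega) hl L
  have l2 := (tendsto_add_atTop_nat h).eventually l1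
  set B := c2 ^ r * (2 * c4 / c3) ^ (r+1) / c1 ^ r with hB
  filter_upwards [l1, l2, tendsto_natCast_atTop_atTop.eventually e1,
    tendsto_natCast_atTop_atTop.eventually e4, tendsto_natCast_atTop_atTop.eventually e5,
    tendsto_natCast_atTop_atTop.eventually (eventually_gt_atTop B),
    tendsto_natCast_atTop_atTop.eventually (eventually_ge_atTop (1:ℝ))]
    with m l1 l2 e1 e4 e5 e6 e7 k k' hk hk'
  have p1 := l1 k hk
  have p2 := l2 k' hk'
  simp only [L, max_le_iff] at p1 p2
  obtain ⟨q1, q2, q3, q4⟩ := p1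
  obtain ⟨q1', -, -, -⟩ := p2
  have e2 := hK2 k q2
  have e3 := hK3 k q3
  simp only [eval_sub, taylor_eval] at e3 e4 e5
  push_cast at hk'
  have hk := abs_le.mp hk
  have hk' := abs_le.mp hk'
  have hgg : g.eval (k:ℝ) < g.eval (k':ℝ) := by linarith
  have hkk : k < k' := by
    by_contra hcon
    have : (k':ℝ) ≤ k := by exact_mod_cast not_lt.mp hcon
    have := hK.monotoneOn (Set.mem_Ici.mpr q1') (Set.mem_Ici.mpr q1) this
    linarith
  have hkk' : (k:ℝ) + 1 ≤ k' := by exact_mod_cast hkk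
  have hg1 := hK.monotoneOn (Set.mem_Ici.mpr (by linarith)) (Set.mem_Ici.mpr q1') hkk'
  have A1 : c1 * (m:ℝ) ^ (n+1) ≤ c2 * (k:ℝ) ^ (r+1) := by linarith
  have A2 : c3 * (k:ℝ) ^ r ≤ 2 * c4 * (m:ℝ) ^ n := by linarith
  have A3 : (k:ℝ) ^ r ≤ (2 * c4 / c3) * (m:ℝ) ^ n := by
    rw [div_mul_eq_mul_div, le_div_iff₀ hc3]; linarith
  have A4 : (c1 * (m:ℝ) ^ (n+1)) ^ r ≤ (c2 * (k:ℝ) ^ (r+1)) ^ r :=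
    pow_le_pow_left₀ (by positivity) A1 r
  have A5 : ((k:ℝ) ^ r) ^ (r+1) ≤ ((2 * c4 / c3) * (m:ℝ) ^ n) ^ (r+1) :=
    pow_le_pow_left₀ (by positivity) A3 _
  obtain ⟨u, hu⟩ : ∃ u, r = n + 1 + u := ⟨r - n - 1, by omega⟩
  have A6 : c1 ^ r * ((m:ℝ) ^ (n * (r+1)) * (m:ℝ) ^ (u+1)) ≤
      c2 ^ r * ((2 * c4 / c3) ^ (r+1) * (m:ℝ) ^ (n * (r+1))) := by
    calc c1 ^ r * ((m:ℝ) ^ (n * (r+1)) * (m:ℝ) ^ (u+1)) = (c1 * (m:ℝ) ^ (n+1)) ^ r := by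
          rw [mul_pow, ← pow_add, ← pow_mul]; congr 2; rw [hu]; ring
      _ ≤ (c2 * (k:ℝ) ^ (r+1)) ^ r := A4
      _ = c2 ^ r * ((k:ℝ) ^ r) ^ (r+1) := by
          rw [mul_pow, ← pow_mul, ← pow_mul, mul_comm r]
      _ ≤ c2 ^ r * ((2 * c4 / c3) * (m:ℝ) ^ n) ^ (r+1) := by gcongr
      _ = _ := by rw [mul_pow, ← pow_mul]
  have hm0 : (0:ℝ) < (m:ℝ) ^ (n * (r+1)) := by positivity
  have A7 : (m:ℝ) ^ (u+1) ≤ B := by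
    rw [hB, le_div_iff₀ (by positivity)]
    refine le_of_mul_le_mul_left ?_ hm0
    linarith
  have A8 : (m:ℝ) ≤ (m:ℝ) ^ (u+1) := le_self_pow₀ e7 (by omega)
  linarith

theorem lemInt (z : ℝ) : ∃ δ > 0, ∀ i : ℤ, |(i:ℝ) - z| < δ → (i:ℝ) = z := by
  by_cases h : z = round z
  · refine ⟨1, one_pos, fun i hi => ?_⟩
    rw [h] at hi ⊢
    have : |i - round z| < 1 := by exact_mod_cast hi
    have := Int.abs_lt_one_iff.mp this
    have : i = round z := by omega
    exact_mod_cast this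
  · refine ⟨|z - round z|, abs_pos.mpr (sub_ne_zero.mpr h), fun i hi => ?_⟩
    have := round_le z i
    rw [abs_sub_comm] at hi
    linarith

theorem lemClose (G : ℝ → ℝ) (hG : G =o[atTop] fun x : ℝ => x) (F g : ℝ[X]) (n : ℕ) (hn : 1 ≤ n)
    (hF : F.natDegree = n + 1) (hg : g.natDegree = n + 1)
    (hl : 0 < F.leadingCoeff) (hgl : 0 < g.leadingCoeff) (β : ℝ) (hβ : 0 < β)
    (hβl : g.leadingCoeff * β ^ (n+1) = F.leadingCoeff) :
    ∃ s : ℝ, ∀ ε > 0, ∀ᶠ m : ℕ in atTop, ∀ k : ℕ,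
      |F.eval (m:ℝ) - g.eval (k:ℝ)| ≤ G m → |(k:ℝ) - β * (m + s)| < ε := by
  obtain ⟨K, hK⟩ := lemMono g (by omega) hgl
  set H := g.comp (C β * X) with hH
  have hHn : H.natDegree = n + 1 := by
    rw [hH, natDegree_comp, natDegree_C_mul_X _ hβ.ne', hg, mul_one]
  have hHl : F.leadingCoeff = H.leadingCoeff := by
    have h1 : H.leadingCoeff = g.coeff (n+1) * β ^ (n+1) := by
      rw [leadingCoeff, hHn, hH, comp_C_mul_X_coeff]
    rw [h1, ← hβl, leadingCoeff, hg]
  have hHe : ∀ x, H.eval x = g.eval (β * x) := by intro x; simp [hH]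
  have hp : 0 < ((n:ℝ) + 1) * H.leadingCoeff := by rw [← hHl]; positivity
  refine ⟨(F.coeff n - H.coeff n) / ((n + 1) * H.leadingCoeff), ?_⟩
  intro ε hε
  set s := (F.coeff n - H.coeff n) / ((n + 1) * H.leadingCoeff) with hs
  have hs' : ((n:ℝ) + 1) * H.leadingCoeff * s = F.coeff n - H.coeff n := by
    rw [hs]; exact mul_div_cancel₀ _ hp.ne'
  have hpe : 0 < ((n:ℝ) + 1) * H.leadingCoeff * (ε / β) := by positivity
  obtain ⟨a1, a2⟩ := taylorPos F H n hF hHn hHl (s + ε / β) (by rw [mul_add]; linarith)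
  obtain ⟨b1, b2⟩ := taylorNeg F H n hF hHn hHl (s - ε / β) (by rw [mul_sub]; linarith)
  filter_upwards [lemLarge G hG F g (by omega) hl K,
    tendsto_natCast_atTop_atTop.eventually (lemA G hG _ (by omega) a2 0),
    tendsto_natCast_atTop_atTop.eventually (lemA G hG _ (by omega) b2 0),
    tendsto_natCast_atTop_atTop.eventually (eventually_ge_atTop (K / β - s))]
    with m h1 h2 h3 h4 k hk
  have hkK := h1 k hk
  simp only [eval_sub, taylor_eval, hHe] at h2 h3
  have hab := abs_le.mp hk
  have e1 : β * (m + (s + ε / β)) = β * (m + s) + ε := by field_simp; ring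
  have e2 : β * (m + (s - ε / β)) = β * (m + s) - ε := by field_simp; ring
  rw [e1] at h2
  rw [e2] at h3
  have h5 : K ≤ β * (m + s) := by
    rw [sub_le_iff_le_add, div_le_iff₀ hβ] at h4; linarith
  rw [abs_lt]
  constructor
  · by_contra hcon
    have hle : (k:ℝ) ≤ β * (m + s) - ε := by linarith
    have := hK.monotoneOn (Set.mem_Ici.mpr hkK) (Set.mem_Ici.mpr (hkK.trans hle)) hle
    linarith
  · by_contra hcon
    have hle : β * (m + s) + ε ≤ k := by linarith
    have := hK.monotoneOn (Set.mem_Ici.mpr (by linarith)) (Set.mem_Ici.mpr hkK) hle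
    linarith

theorem lemAbs (G : ℝ → ℝ) (hG : G =o[atTop] fun x : ℝ => x) (P : ℝ[X])
    (hd : 1 ≤ P.natDegree) :
    ∀ᶠ x in atTop, G x < |P.eval x| := by
  have h0 : P.leadingCoeff ≠ 0 := by
    rw [Ne, leadingCoeff_eq_zero]; rintro rfl; simp at hd
  rcases lt_or_gt_of_ne h0 with h | h
  · filter_upwards [lemA G hG (-P) (by rwa [natDegree_neg]) (by rw [leadingCoeff_neg]; linarith) 0]
      with x hx
    rw [eval_neg] at hx
    have := neg_le_abs (P.eval x)
    linarith
  · filter_upwards [lemA G hG P hd h 0] with x hx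
    have := le_abs_self (P.eval x)
    linarith

theorem lemJ (G : ℝ → ℝ) (hG : G =o[atTop] fun x : ℝ => x) (f g : ℚ[X])
    (hfi : IsIntegerValued f) (hgi : IsIntegerValued g)
    (hd : 2 ≤ f.natDegree) (hl : 0 < f.leadingCoeff) (hgl : 0 < g.leadingCoeff)
    (hle : f.natDegree ≤ g.natDegree) (A : ℤ) (hA : NonEquivAt f g A) :
    ∃ q : ℕ, 0 < q ∧ ∀ h : ℕ, 0 < h → ∀ᶠ m : ℕ in atTop, (m:ℤ) ≡ A [ZMOD (q:ℤ)] →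
      ∀ k k' : ℕ, 0 < k → |((f.eval (m:ℚ) : ℚ) : ℝ) - ((g.eval (k:ℚ) : ℚ) : ℝ)| ≤ G m →
      |((f.eval ((m + h : ℕ):ℚ) : ℚ) : ℝ) - ((g.eval (k':ℚ) : ℚ) : ℝ)| ≤ G (m + h : ℕ) → False := by
  set F := f.map (algebraMap ℚ ℝ) with hFdef
  set g' := g.map (algebraMap ℚ ℝ) with hgdef
  have eF : ∀ n : ℕ, ((f.eval (n:ℚ) : ℚ) : ℝ) = F.eval (n:ℝ) := by
    intro n; rw [hFdef, eval_natCast_map]; rfl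
  have eg : ∀ n : ℕ, ((g.eval (n:ℚ) : ℚ) : ℝ) = g'.eval (n:ℝ) := by
    intro n; rw [hgdef, eval_natCast_map]; rfl
  have nF : F.natDegree = f.natDegree := natDegree_map _
  have ng : g'.natDegree = g.natDegree := natDegree_map _
  have lF : F.leadingCoeff = (f.leadingCoeff : ℝ) := leadingCoeff_map _
  have lg : g'.leadingCoeff = (g.leadingCoeff : ℝ) := leadingCoeff_map _
  have lF0 : 0 < F.leadingCoeff := by rw [lF]; exact_mod_cast hl
  have lg0 : 0 < g'.leadingCoeff := by rw [lg]; exact_mod_cast hgl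
  rcases hle.lt_or_eq with hlt | heq
  · refine ⟨1, one_pos, fun h hh => ?_⟩
    filter_upwards [lemBig G hG F g' (by omega) lF0 lg0 (by omega) h hh] with m hm _ k k' _ h1 h2
    rw [eF, eg] at h1 h2
    exact hm k k' h1 h2
  obtain ⟨n, hn⟩ : ∃ n, f.natDegree = n + 1 := ⟨f.natDegree - 1, by omega⟩
  obtain ⟨β, hβ, hβl⟩ : ∃ β : ℝ, 0 < β ∧ g'.leadingCoeff * β ^ (n+1) = F.leadingCoeff := by
    refine ⟨(F.leadingCoeff / g'.leadingCoeff) ^ (((n+1 : ℕ) : ℝ)⁻¹), by positivity, ?_⟩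
    rw [Real.rpow_inv_natCast_pow (by positivity) (by omega)]
    field_simp
  obtain ⟨s, hs⟩ := lemClose G hG F g' n (by omega) (by omega) (by omega) lF0 lg0 β hβ hβl
  by_cases hrat : ∃ b : ℚ, (b:ℝ) = β
  · obtain ⟨b, rfl⟩ := hrat
    have hb : 0 < b := by exact_mod_cast hβ
    have hden : (0:ℝ) < b.den := by exact_mod_cast b.den_pos
    refine ⟨b.den, b.den_pos, fun h hh => ?_⟩
    suffices ∀ᶠ m : ℕ in atTop, (m:ℤ) ≡ A [ZMOD (b.den:ℤ)] → ∀ k : ℕ, 0 < k →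
        |F.eval (m:ℝ) - g'.eval (k:ℝ)| ≤ G m → False by
      filter_upwards [this] with m hm hmA k k' hk h1 _
      rw [eF, eg] at h1
      exact hm hmA k hk h1
    by_contra hcon
    have hfreq : ∃ᶠ m : ℕ in atTop, (m:ℤ) ≡ A [ZMOD (b.den:ℤ)] ∧ ∃ k : ℕ, 0 < k ∧
        |F.eval (m:ℝ) - g'.eval (k:ℝ)| ≤ G m := by
      intro h'
      apply hcon
      filter_upwards [h'] with m hm a k hk hb
      exact hm ⟨a, k, hk, hb⟩
    obtain ⟨δ, hδ, hint⟩ := lemInt (b.den * b * s)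
    have hexact : ∀ᶠ m : ℕ in atTop, ∀ k : ℕ,
        |F.eval (m:ℝ) - g'.eval (k:ℝ)| ≤ G m → (k:ℝ) = b * (m + s) := by
      filter_upwards [hs (δ / b.den) (by positivity)] with m hm k hk
      have h1 := hm k hk
      have hnum : (b:ℝ) * b.den = b.num := by exact_mod_cast Rat.mul_den_eq_num b
      have h2 := hint (b.den * k - b.num * m) (by
        rw [lt_div_iff₀ hden] at h1
        push_cast
        rw [← hnum]
        have : (b.den:ℝ) * k - b * b.den * m - b.den * b * s = (k - b * (m + s)) * b.den := by ring
        rwa [this, abs_mul, abs_of_pos hden])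
      push_cast at h2
      rw [← hnum] at h2
      apply mul_left_cancel₀ hden.ne'
      linarith
    -- a witness
    obtain ⟨m, ⟨hmA, k, hk, hbad⟩, hm0, hex⟩ :=
      (hfreq.and_eventually ((eventually_gt_atTop 0).and hexact)).exists
    have hk1 := hex k hbad
    set t : ℚ := k / b - m with ht
    have hst : s = (t:ℝ) := by
      have hb' : (b:ℝ) ≠ 0 := hβ.ne'
      rw [ht]; push_cast; rw [hk1]; field_simp; ring
    set P : ℚ[X] := g.comp (C b * (X + C t)) - f with hP
    have ePq : ∀ x : ℚ, P.eval x = g.eval (b * (x + t)) - f.eval x := by intro x; simp [hP]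
    have eP : ∀ m k : ℕ, (k:ℝ) = b * (m + s) →
        (P.map (algebraMap ℚ ℝ)).eval (m:ℝ) = g'.eval (k:ℝ) - F.eval (m:ℝ) := by
      intro m k hk
      rw [eval_natCast_map, ePq, ← eF, ← eg]
      have : (k:ℚ) = b * (m + t) := by rw [hst] at hk; exact_mod_cast hk
      rw [← this]; push_cast; rfl
    by_cases hPd : 1 ≤ P.natDegree
    · have h1 := tendsto_natCast_atTop_atTop.eventually
        (lemAbs G hG (P.map (algebraMap ℚ ℝ)) (by rwa [natDegree_map]))
      obtain ⟨m, ⟨_, k, hk, hbad⟩, hex, habs⟩ := (hfreq.and_eventually (hexact.and h1)).exists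
      rw [eP m k (hex k hbad), abs_sub_comm] at habs
      linarith
    · have hPc : P = C (P.coeff 0) := eq_C_of_natDegree_eq_zero (by omega)
      obtain ⟨u, hu⟩ := hfi m hm0
      obtain ⟨v, hv⟩ := hgi k hk
      have hkt : (k:ℚ) = b * (m + t) := by rw [hst] at hk1; exact_mod_cast hk1
      have hc0 : P.coeff 0 = ((v - u : ℤ) : ℚ) := by
        have : P.eval (m:ℚ) = P.coeff 0 := by conv_lhs => rw [hPc, eval_C]
        rw [← this, ePq, ← hkt, hu, hv]; push_cast; rfl
      obtain ⟨w, hw⟩ := hmA.dvd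
      refine hA b hb (k + b.num * w) (u - v) ?_
      have hf : f = g.comp (C b * (X + C t)) - C ((v - u : ℤ) : ℚ) := by
        rw [← hc0, ← hPc, hP]; ring
      have hCC : b * (A + t) = ((k + b.num * w : ℤ) : ℚ) := by
        have hw' : (A:ℚ) = m + b.den * w := by
          have : A = m + b.den * w := by linarith
          exact_mod_cast this
        have hnum : b * b.den = b.num := Rat.mul_den_eq_num b
        rw [hw']; push_cast; rw [← hnum, hkt]; ring
      rw [← hCC]
      conv_lhs => rw [hf]
      simp only [sub_comp, comp_assoc, mul_comp, add_comp, X_comp, C_comp]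
      rw [sub_eq_add_neg, ← C_neg]
      congr 2
      · simp only [C_mul, C_add]; ring
      · push_cast; ring
  · refine ⟨1, one_pos, fun h hh => ?_⟩
    obtain ⟨δ, hδ, hint⟩ := lemInt (β * h)
    have e1 := hs (δ / 2) (by positivity)
    have e2 := (tendsto_add_atTop_nat h).eventually e1
    filter_upwards [e1, e2] with m h1 h2 _ k k' _ hk hk'
    rw [eF, eg] at hk hk'
    have a1 := abs_lt.mp (h1 k hk)
    have a2 := abs_lt.mp (h2 k' hk')
    push_cast at a2
    have := hint ((k':ℤ) - k) (by
      push_cast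
      rw [abs_lt]; constructor <;> linarith)
    apply hrat
    have hh' : (h:ℝ) ≠ 0 := by exact_mod_cast hh.ne'
    refine ⟨((k':ℚ) - k) / h, ?_⟩
    push_cast at this ⊢
    rw [this]; field_simp

theorem stmt8 (ℓ : ℕ) (hℓ : 0 < ℓ)
    (f : Fin ℓ → Polynomial ℚ)
    (hfint : ∀ j, IsIntegerValued (f j))
    (hfdeg : ∀ j, 2 ≤ (f j).natDegree)
    (hflead : ∀ j, 0 < (f j).leadingCoeff)
    (hfmin : ∀ j, (f ⟨0, hℓ⟩).natDegree ≤ (f j).natDegree)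
    (A : ℤ)
    (hA : ∀ j : Fin ℓ, j ≠ ⟨0, hℓ⟩ → NonEquivAt (f ⟨0, hℓ⟩) (f j) A)
    (E : ℕ) (hE : 0 < E)
    (G : ℝ → ℝ)
    (hGo : G =o[atTop] fun x : ℝ => x)
    (hGtop : Tendsto G atTop atTop) :
    ∀ M : ℕ, ∃ m : ℕ, M ≤ m ∧ 0 < m ∧ (m : ℤ) ≡ A [ZMOD (E : ℤ)] ∧
      ∀ (j : Fin ℓ) (k : ℕ), 0 < k → (j, k) ≠ (⟨0, hℓ⟩, m) →
        G (m : ℝ) <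
          |(((f ⟨0, hℓ⟩).eval ((m : ℕ) : ℚ) : ℚ) : ℝ) - (((f j).eval ((k : ℕ) : ℚ) : ℚ) : ℝ)| := by
  intro M
  have key : ∀ j : Fin ℓ, ∃ q : ℕ, 0 < q ∧ ∀ h : ℕ, 0 < h → ∀ᶠ m : ℕ in atTop,
      (m:ℤ) ≡ A [ZMOD (q:ℤ)] → ∀ k k' : ℕ, 0 < k → (j, k) ≠ (⟨0, hℓ⟩, m) →
      |(((f ⟨0, hℓ⟩).eval (m:ℚ) : ℚ) : ℝ) - (((f j).eval (k:ℚ) : ℚ) : ℝ)| ≤ G m →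
      |(((f ⟨0, hℓ⟩).eval ((m + h : ℕ):ℚ) : ℚ) : ℝ) - (((f j).eval (k':ℚ) : ℚ) : ℝ)|
        ≤ G (m + h : ℕ) → False := by
    intro j
    by_cases hj : j = ⟨0, hℓ⟩
    · subst hj
      refine ⟨1, one_pos, fun h _ => ?_⟩
      have := lemSelf G hGo ((f ⟨0, hℓ⟩).map (algebraMap ℚ ℝ)) (by
        rw [natDegree_map]; exact hfdeg _) (by
        rw [leadingCoeff_map]; exact Rat.cast_pos.mpr (hflead _))
      filter_upwards [this] with m hm _ k k' hk hne h1 _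
      have h2 := hm k (by rintro rfl; exact hne rfl)
      rw [eval_natCast_map, eval_natCast_map] at h2
      exact absurd h1 (not_le.mpr h2)
    · obtain ⟨q, hq, h⟩ := lemJ G hGo (f ⟨0, hℓ⟩) (f j) (hfint _) (hfint _) (hfdeg _) (hflead _)
        (hflead _) (hfmin j) A (hA j hj)
      refine ⟨q, hq, fun h' hh' => ?_⟩
      filter_upwards [h h' hh'] with m hm hmA k k' hk _ h1 h2
      exact hm hmA k k' hk h1 h2
  choose q hq hkey using key
  set N := E * ∏ j, q j with hN
  have hNpos : 0 < N := Nat.mul_pos hE (Finset.prod_pos fun j _ => hq j)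
  have hev : ∀ᶠ m : ℕ in atTop, ∀ j : Fin ℓ, ∀ i ∈ Finset.Icc 1 ℓ, 
      (m:ℤ) ≡ A [ZMOD (q j:ℤ)] → ∀ k k' : ℕ, 0 < k → (j, k) ≠ (⟨0, hℓ⟩, m) →
      |(((f ⟨0, hℓ⟩).eval (m:ℚ) : ℚ) : ℝ) - (((f j).eval (k:ℚ) : ℚ) : ℝ)| ≤ G m →
      |(((f ⟨0, hℓ⟩).eval ((m + i * N : ℕ):ℚ) : ℚ) : ℝ) - (((f j).eval (k':ℚ) : ℚ) : ℝ)|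
        ≤ G (m + i * N : ℕ) → False := by
    rw [eventually_all]
    intro j
    rw [Filter.eventually_all_finset]
    intro i hi
    exact hkey j (i * N) (Nat.mul_pos (Finset.mem_Icc.mp hi).1 hNpos)
  obtain ⟨M', hM'⟩ := eventually_atTop.mp hev
  obtain ⟨m0, hm0, hm0A⟩ : ∃ m0 : ℕ, M + M' + 1 ≤ m0 ∧ (m0:ℤ) ≡ A [ZMOD (N:ℤ)] := by
    have hN0 : (0:ℤ) < N := by exact_mod_cast hNpos
    have hmod := Int.emod_nonneg A hN0.ne'
    refine ⟨(A % N).toNat + N * (M + M' + 1), ?_, ?_⟩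
    · have : 1 * (M + M' + 1) ≤ N * (M + M' + 1) := Nat.mul_le_mul_right _ hNpos
      omega
    · push_cast
      rw [Int.toNat_of_nonneg hmod]
      unfold Int.ModEq
      rw [Int.add_mul_emod_self_left, Int.emod_emod]
  have hmA : ∀ i : ℕ, ((m0 + i * N : ℕ):ℤ) ≡ A [ZMOD (N:ℤ)] := by
    intro i
    have : ((m0 + i * N : ℕ):ℤ) ≡ m0 [ZMOD (N:ℤ)] := by
      unfold Int.ModEq
      push_cast
      rw [Int.add_mul_emod_self_right]
    exact this.trans hm0A
  have hEN : (E:ℤ) ∣ N := by rw [hN]; push_cast; exact Dvd.intro _ rfl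
  have hqN : ∀ j, (q j:ℤ) ∣ N := by
    intro j
    exact_mod_cast (Finset.dvd_prod_of_mem q (Finset.mem_univ j)).trans (Dvd.intro_left E rfl)
  by_contra hcon
  push Not at hcon
  have hbad : ∀ i : Fin (ℓ + 1), ∃ (j : Fin ℓ) (k : ℕ), 0 < k ∧
      (j, k) ≠ (⟨0, hℓ⟩, m0 + i * N) ∧
      |(((f ⟨0, hℓ⟩).eval ((m0 + i * N : ℕ):ℚ) : ℚ) : ℝ) - (((f j).eval (k:ℚ) : ℚ) : ℝ)|
        ≤ G (m0 + i * N : ℕ) := by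
    intro i
    exact hcon (m0 + i * N) (by omega) (by omega) ((hmA i).of_dvd hEN)
  choose jj kk hk1 hk2 hk3 using hbad
  have main : ∀ i i' : Fin (ℓ + 1), i < i' → jj i = jj i' → False := by
    intro i i' hlt heq
    have hi' := i'.isLt
    have hlt' : (i:ℕ) < i' := hlt
    have hadd : m0 + i * N + ((i':ℕ) - i) * N = m0 + i' * N := by
      rw [add_assoc, ← add_mul]; congr 2; omega
    refine hM' (m0 + i * N) (by omega) (jj i) ((i':ℕ) - i) (Finset.mem_Icc.mpr (by omega))
      ((hmA i).of_dvd (hqN _)) (kk i) (kk i') (hk1 i) (hk2 i) (hk3 i) ?_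
    rw [hadd, heq]
    exact hk3 i'
  obtain ⟨i, i', hne, heq⟩ := Fintype.exists_ne_map_eq_of_card_lt jj (by simp)
  rcases lt_or_gt_of_ne hne with h | h
  · exact main i i' h heq
  · exact main i' i h heq.symm
end

section
/- Let g(x) be an integer-valued polynomial of degree d ≥ 1 with positive leading coefficient. Let U = {(i, j) : 1 ≤ i ≤ ℓ_1, 1 ≤ j ≤ ℓ_2, dj ≥ 2}, and for each (i, j) ∈ U set f_{i,j}(x) = i·g(x)^j + h_{i,j}(x), where h_{i,j}(x) is any integer-valued polynomial of degree ≤ dj − 2. Then for every non-empty subset S of U there exist a pair (i, j) ∈ S and an integer A such that f_{i,j}(x + A) is not identically equal to f_{i',j'}(Bx + C) + D for any (i', j') ∈ S \ {(i, j)}, any integers C, D, and any positive rational number B. -/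
open Polynomial Filter

lemma coeff_lin (p : Polynomial ℚ) (n : ℕ) (hn : 1 ≤ n) (hp : p.natDegree ≤ n) (B c : ℚ) :
    (p.comp (Polynomial.C B * X + Polynomial.C c)).coeff n = p.coeff n * B ^ n ∧
    (p.comp (Polynomial.C B * X + Polynomial.C c)).coeff (n - 1) =
      (p.coeff (n - 1) + n * c * p.coeff n) * B ^ (n - 1) := by
  have e : p.comp (Polynomial.C B * X + Polynomial.C c) =
      (taylor c p).comp (Polynomial.C B * X) := by
    rw [taylor_apply, comp_assoc]; simp
  obtain ⟨m, rfl⟩ : ∃ m, n = m + 1 := ⟨n - 1, by omega⟩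
  rw [e, comp_C_mul_X_coeff, comp_C_mul_X_coeff, taylor_coeff, taylor_coeff]
  have h1 : (hasseDeriv (m+1) p).natDegree < 1 := by
    have := natDegree_hasseDeriv_le p (m+1); omega
  have h2 : (hasseDeriv m p).natDegree < 2 := by
    have := natDegree_hasseDeriv_le p m; omega
  constructor
  · rw [eval_eq_sum_range' h1]
    simp [hasseDeriv_coeff]
  · simp only [Nat.add_sub_cancel]
    rw [eval_eq_sum_range' h2]
    simp [Finset.sum_range_succ, hasseDeriv_coeff, add_comm 1 m]
    left; ring

lemma exists_A (t : ℚ) (L : ℕ) : ∃ (A : ℤ) (P : ℕ), P.Prime ∧ L < P ∧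
    (A : ℚ) + t = P / t.den := by
  have hu : IsUnit ((t.num : ℤ) : ZMod t.den) := by
    rw [ZMod.coe_int_isUnit_iff_isCoprime]
    rw [Int.isCoprime_iff_gcd_eq_one]
    have := t.reduced
    rw [Int.gcd_comm]
    simpa [Int.gcd, Nat.Coprime] using this
  haveI : NeZero t.den := ⟨t.den_nz⟩
  obtain ⟨P, hP1, hP2, hP3⟩ := Nat.forall_exists_prime_gt_and_eq_mod hu L
  have : ((P : ℤ) : ZMod t.den) = ((t.num : ℤ) : ZMod t.den) := by simpa using hP3
  rw [ZMod.intCast_eq_intCast_iff_dvd_sub] at this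
  obtain ⟨k, hk⟩ := this
  refine ⟨-k, P, hP2, hP1, ?_⟩
  have hd : (t.den : ℚ) ≠ 0 := by exact_mod_cast t.den_nz
  rw [eq_div_iff hd, add_mul, Rat.mul_den_eq_num]
  have : (t.num : ℚ) - P = t.den * k := by exact_mod_cast hk
  push_cast
  linarith

lemma arith (n i i' P L : ℕ) (B : ℚ) (Q : ℤ) (hn : 1 ≤ n) (hi' : 1 ≤ i') (hL : i' ≤ L)
    (hP : P.Prime) (hPL : L < P) (hB : 0 < B) (h1 : (i : ℚ) = i' * B ^ n)
    (h2 : B * P = Q) (hle : i ≤ i') : i = i' := by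
  have hP0 : (P : ℚ) ≠ 0 := by exact_mod_cast hP.ne_zero
  have h3 : (i : ℤ) * P ^ n = i' * Q ^ n := by
    have : (i : ℚ) * P ^ n = i' * Q ^ n := by rw [h1, ← h2]; ring
    exact_mod_cast this
  have hPi : Prime (P : ℤ) := Nat.prime_iff_prime_int.mp hP
  have hd : (P : ℤ) ∣ i' * Q ^ n := by
    rw [← h3]; exact Dvd.dvd.mul_left (dvd_pow_self _ (by omega)) _
  rcases hPi.dvd_or_dvd hd with h4 | h4
  · have := Nat.le_of_dvd (by omega) (Int.natCast_dvd_natCast.mp h4)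
    omega
  · obtain ⟨k, hk⟩ := hPi.dvd_of_dvd_pow h4
    have hBk : B = k := by
      rw [hk] at h2; push_cast at h2
      apply mul_right_cancel₀ hP0; rw [h2]; ring
    have hk1 : (1 : ℚ) ≤ B := by
      rw [hBk] at hB ⊢
      have : 0 < k := by exact_mod_cast hB
      exact_mod_cast this
    have h5 : (1 : ℚ) ≤ B ^ n := one_le_pow₀ hk1
    have h6 : (i' : ℚ) ≤ i := by
      rw [h1]; exact le_mul_of_one_le_right (by positivity) h5
    have : i' ≤ i := by exact_mod_cast h6
    omega

theorem stmt9 (ℓ₁ ℓ₂ : ℕ) (g : Polynomial ℚ) (d : ℕ)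
    (hgd : g.natDegree = d) (hd : 1 ≤ d)
    (hgint : IsIntegerValued g)
    (hglead : 0 < g.leadingCoeff)
    (U : Finset (ℕ × ℕ))
    (hU : ∀ p : ℕ × ℕ, p ∈ U ↔
      (1 ≤ p.1 ∧ p.1 ≤ ℓ₁ ∧ 1 ≤ p.2 ∧ p.2 ≤ ℓ₂ ∧ 2 ≤ d * p.2))
    (h : ℕ → ℕ → Polynomial ℚ)
    (hhint : ∀ p ∈ U, IsIntegerValued (h p.1 p.2))
    (hhdeg : ∀ p ∈ U, (h p.1 p.2).natDegree ≤ d * p.2 - 2)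
    (f : ℕ → ℕ → Polynomial ℚ)
    (hf : ∀ p ∈ U, f p.1 p.2 = Polynomial.C ((p.1 : ℚ)) * g ^ p.2 + h p.1 p.2) :
    ∀ S : Finset (ℕ × ℕ), S ⊆ U → S.Nonempty →
      ∃ p ∈ S, ∃ A : ℤ, ∀ p' ∈ S, p' ≠ p → NonEquivAt (f p.1 p.2) (f p'.1 p'.2) A := by
  intro S hS hne
  obtain ⟨p, hpS, hmin⟩ := Finset.exists_min_image S (fun p => p.1) hne
  obtain ⟨hp1, hp2, hp3, hp4, hp5⟩ := (hU p).1 (hS hpS)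
  have ha : g.leadingCoeff ≠ 0 := hglead.ne'
  have hg0 : g ≠ 0 := leadingCoeff_ne_zero.mp ha
  have hpd : ∀ j, (g ^ j).natDegree = d * j := fun j => by
    rw [natDegree_pow, hgd, mul_comm]
  have hc : ∀ q ∈ U, (f q.1 q.2).natDegree = d * q.2 ∧
      (f q.1 q.2).coeff (d * q.2) = q.1 * (g ^ q.2).coeff (d * q.2) ∧
      (f q.1 q.2).coeff (d * q.2 - 1) = q.1 * (g ^ q.2).coeff (d * q.2 - 1) := by
    intro q hq
    obtain ⟨hq1, hq2, hq3, hq4, hq5⟩ := (hU q).1 hq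
    have hh := hhdeg q hq
    have hq0 : (q.1 : ℚ) ≠ 0 := by exact_mod_cast (by omega : q.1 ≠ 0)
    rw [hf q hq]
    refine ⟨?_, ?_, ?_⟩
    · rw [natDegree_add_eq_left_of_natDegree_lt, natDegree_C_mul hq0, hpd]
      rw [natDegree_C_mul hq0, hpd]; omega
    · rw [coeff_add, coeff_C_mul, coeff_eq_zero_of_natDegree_lt (by omega : (h q.1 q.2).natDegree < _), add_zero]
    · rw [coeff_add, coeff_C_mul, coeff_eq_zero_of_natDegree_lt (by omega : (h q.1 q.2).natDegree < _), add_zero]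
  obtain ⟨hf1, hf2, hf3⟩ := hc p (hS hpS)
  have hα : (g ^ p.2).coeff (d * p.2) ≠ 0 := by
    rw [← hpd, coeff_natDegree]; exact leadingCoeff_ne_zero.mpr (pow_ne_zero _ hg0)
  set n := d * p.2 with hn
  set α := (g ^ p.2).coeff n with hαdef
  set e := (g ^ p.2).coeff (n - 1) with hedef
  have hn0 : (n : ℚ) ≠ 0 := by exact_mod_cast (by omega : n ≠ 0)
  obtain ⟨A, P, hP, hPL, hA⟩ := exists_A (e / (n * α)) ℓ₁
  refine ⟨p, hpS, A, ?_⟩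
  intro q hqS hqp B hB c D heq
  obtain ⟨hq1, hq2, hq3, hq4, hq5⟩ := (hU q).1 (hS hqS)
  obtain ⟨hk1, hk2, hk3⟩ := hc q (hS hqS)
  have hj : q.2 = p.2 := by
    have := congrArg natDegree heq
    rw [natDegree_add_C, natDegree_comp, natDegree_comp, natDegree_X_add_C,
      natDegree_linear hB.ne', hf1, hk1, mul_one, mul_one, hn] at this
    exact (Nat.eq_of_mul_eq_mul_left hd this).symm
  rw [hj] at hk1 hk2 hk3 heq
  rw [← hn] at hk1 hk2 hk3
  rw [← hαdef] at hk2
  rw [← hedef] at hk3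
  obtain ⟨u1, u2⟩ := coeff_lin (f p.1 p.2) n (by omega) hf1.le 1 A
  obtain ⟨v1, v2⟩ := coeff_lin (f q.1 p.2) n (by omega) hk1.le B c
  rw [C_1, one_mul] at u1 u2
  rw [heq, coeff_add, coeff_C_ne_zero (by omega), v1, hf2, hk2] at u1
  rw [heq, coeff_add, coeff_C_ne_zero (by omega), v2, hf2, hf3, hk2, hk3] at u2
  simp only [one_pow, mul_one, add_zero] at u1 u2
  have w1 : (p.1 : ℚ) = q.1 * B ^ n := by
    apply mul_right_cancel₀ hα; rw [← u1]; ring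
  have hp0 : (p.1 : ℚ) ≠ 0 := by exact_mod_cast (by omega : p.1 ≠ 0)
  set t := e / (n * α) with ht
  have het : e = t * (n * α) := by rw [ht]; field_simp
  have hBn : B ^ n = B ^ (n - 1) * B := by rw [← pow_succ]; congr 1; omega
  have w2 : B * (A + t) = c + t := by
    have h0 : (p.1 : ℚ) * n * α ≠ 0 := mul_ne_zero (mul_ne_zero hp0 hn0) hα
    apply mul_left_cancel₀ h0
    have : B * (p.1 * e + n * A * (p.1 * α)) = (e + n * c * α) * (q.1 * B ^ n) := by
      rw [← u2, hBn]; ring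
    rw [← w1, het] at this
    linear_combination this
  have hd0 : (t.den : ℚ) ≠ 0 := by exact_mod_cast t.den_nz
  have w3 : B * P = ((c * t.den + t.num : ℤ) : ℚ) := by
    have hPe : (P : ℚ) = (A + t) * t.den := by rw [hA]; field_simp
    have : t * t.den = t.num := Rat.mul_den_eq_num t
    push_cast
    rw [hPe, ← this]
    linear_combination (t.den : ℚ) * w2
  have := arith n p.1 q.1 P ℓ₁ B _ (by omega) hq1 hq2 hP hPL hB w1 w3 (hmin q hqS)
  exact hqp (Prod.ext this.symm hj)
end

section
/- Let f_1(x), …, f_ℓ(x) be polynomials with rational coefficients such that f_{j_1} ∼ f_{j_2} for all 1 ≤ j_1 ≤ j_2 ≤ ℓ. Then there exists a polynomial g(x) with rational coefficients together with integers B_j > 0, C_j, D_j (j = 1, …, ℓ) such that g(x) = f_j((x + C_j)/B_j) + D_j identically for every j = 1, …, ℓ. -/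
open Polynomial

/-- `F ∼ G` : there exist a positive rational `b`, a rational `c` and an integer `d`
such that `F(x) = G(bx + c) + d` identically. -/
def PolySim (F G : Polynomial ℚ) : Prop :=
  ∃ b : ℚ, 0 < b ∧ ∃ c : ℚ, ∃ d : ℤ,
    F = G.comp (Polynomial.C b * X + Polynomial.C c) + Polynomial.C (d : ℚ)

theorem aux_den (q : ℚ) (N : ℕ) (h : q.den ∣ N) : ∃ z : ℤ, (z : ℚ) = N * q := by
  obtain ⟨m, rfl⟩ := h
  refine ⟨m * q.num, ?_⟩
  have := Rat.den_mul_eq_num q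
  push_cast
  rw [← this]
  ring

theorem stmt15 (ℓ : ℕ) (f : Fin ℓ → Polynomial ℚ)
    (hsim : ∀ j₁ j₂ : Fin ℓ, j₁ ≤ j₂ → PolySim (f j₁) (f j₂)) :
    ∃ g : Polynomial ℚ, ∃ B C D : Fin ℓ → ℤ,
      ∀ j : Fin ℓ, 0 < B j ∧
        g = (f j).comp
            (Polynomial.C ((B j : ℚ))⁻¹ * (X + Polynomial.C ((C j : ℚ)))) +
          Polynomial.C ((D j : ℚ)) := by
  rcases ℓ with _ | n
  · exact ⟨0, fun _ => 0, fun _ => 0, fun _ => 0, fun j => j.elim0⟩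
  have h0 : ∀ j, PolySim (f 0) (f j) := fun j => hsim 0 j (Fin.zero_le j)
  choose b hb c d h using h0
  set N : ℕ := ∏ j, ((b j)⁻¹.den * (c j * (b j)⁻¹).den) with hN
  have hNpos : 0 < N := Finset.prod_pos fun j _ => Nat.mul_pos (Rat.den_pos _) (Rat.den_pos _)
  have hdvd : ∀ j, ((b j)⁻¹.den * (c j * (b j)⁻¹).den) ∣ N := fun j =>
    Finset.dvd_prod_of_mem (fun j => ((b j)⁻¹.den * (c j * (b j)⁻¹).den)) (Finset.mem_univ j)
  choose B hB using fun j => aux_den (b j)⁻¹ N ((Dvd.intro _ rfl).trans (hdvd j))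
  choose C' hC using fun j => aux_den (c j * (b j)⁻¹) N ((Dvd.intro_left _ rfl).trans (hdvd j))
  have hNq : (0 : ℚ) < N := by exact_mod_cast hNpos
  refine ⟨(f 0).comp (Polynomial.C ((N : ℚ))⁻¹ * X), B, C', d, fun j => ⟨?_, ?_⟩⟩
  · have : (0 : ℚ) < B j := by
      rw [hB]
      exact mul_pos hNq (inv_pos.mpr (hb j))
    exact_mod_cast this
  · have hbj := (hb j).ne'
    have hN0 := hNq.ne'
    rw [h j, Polynomial.add_comp, Polynomial.C_comp, Polynomial.comp_assoc, hB, hC]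
    congr 2
    simp only [Polynomial.add_comp, Polynomial.mul_comp, Polynomial.C_comp, Polynomial.X_comp]
    rw [mul_add, ← mul_assoc, ← Polynomial.C_mul, ← Polynomial.C_mul]
    congr 3
    · field_simp
    · field_simp
end

section
/- Let g(x) be a polynomial with rational coefficients of degree ≥ 2, let K be a positive integer, and for each integer r with 0 ≤ r ≤ K − 1 define h_r(x) = g(Kx + r). Then for any integers r_1, r_2 with 0 ≤ r_1, r_2 ≤ K − 1 and r_1 ≠ r_2, any integers A, C, D, and any positive rational number B, the polynomial h_{r_1}(x + A) is not identically equal to h_{r_2}(Bx + C) + D. -/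
open Polynomial

theorem stmt16 (g : Polynomial ℚ) (hg : 2 ≤ g.natDegree)
    (K : ℕ) (hK : 0 < K)
    (h : ℕ → Polynomial ℚ)
    (hh : ∀ r : ℕ, r ≤ K - 1 →
      h r = g.comp (Polynomial.C (K : ℚ) * X + Polynomial.C (r : ℚ))) :
    ∀ r₁ r₂ : ℕ, r₁ ≤ K - 1 → r₂ ≤ K - 1 → r₁ ≠ r₂ →
      ∀ (A C D : ℤ) (B : ℚ), 0 < B →
        (h r₁).comp (X + Polynomial.C (A : ℚ)) ≠
          (h r₂).comp (Polynomial.C B * X + Polynomial.C (C : ℚ)) + Polynomial.C (D : ℚ) := by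
  intro r₁ r₂ h1 h2 hne A C D B hB heq
  rw [hh r₁ h1, hh r₂ h2] at heq
  have hK' : (K : ℚ) ≠ 0 := by positivity
  have hev : ∀ x : ℚ, g.eval (K * (x + A) + r₁) = g.eval (K * (B * x + C) + r₂) + D := by
    intro x
    have := congrArg (Polynomial.eval x) heq
    simpa [eval_comp] using this
  have key : g.comp (Polynomial.C (K : ℚ) * X + Polynomial.C (K * A + r₁ : ℚ))
      = g.comp (Polynomial.C (K * B : ℚ) * X + Polynomial.C (K * C + r₂ : ℚ))
        + Polynomial.C (D : ℚ) := by
    apply Polynomial.funext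
    intro x
    have := hev x
    simp only [eval_comp, eval_add, eval_mul, eval_C, eval_X]
    have e1 : (K : ℚ) * x + (K * A + r₁) = K * (x + A) + r₁ := by ring
    have e2 : (K : ℚ) * B * x + (K * C + r₂) = K * (B * x + C) + r₂ := by ring
    rw [e1, e2, this]
  have hco : ∀ a b : ℚ, a ≠ 0 →
      (g.comp (Polynomial.C a * X + Polynomial.C b)).coeff g.natDegree
        = g.leadingCoeff * a ^ g.natDegree := by
    intro a b ha
    have hd : (Polynomial.C a * X + Polynomial.C b).natDegree = 1 := natDegree_linear ha
    have h3 := leadingCoeff_comp (p := g) (q := Polynomial.C a * X + Polynomial.C b)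
      (by rw [hd]; exact one_ne_zero)
    rw [leadingCoeff_linear ha] at h3
    rw [← h3, leadingCoeff, natDegree_comp, hd, mul_one]
  have hg0 : g ≠ 0 := by
    rintro rfl
    simp at hg
  have hB1 : B = 1 := by
    have h4 := congrArg (fun p => p.coeff g.natDegree) key
    simp only [coeff_add] at h4
    rw [hco _ _ hK', hco _ _ (mul_ne_zero hK' hB.ne'), coeff_C, if_neg (by omega), add_zero] at h4
    have h5 := mul_left_cancel₀ (leadingCoeff_ne_zero.mpr hg0) h4
    rw [mul_pow] at h5
    have h6 : B ^ g.natDegree = 1 := by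
      apply mul_left_cancel₀ (pow_ne_zero g.natDegree hK')
      rw [← h5, mul_one]
    exact (pow_eq_one_iff_of_nonneg hB.le (by omega)).mp h6
  subst hB1
  obtain ⟨s, hs⟩ : ∃ s : ℤ, s = K * (A - C) + r₁ - r₂ := ⟨_, rfl⟩
  have hs0 : s ≠ 0 := by
    intro h0
    rw [h0] at hs
    have hdvd : (K : ℤ) ∣ (r₂ : ℤ) - r₁ := ⟨A - C, by linarith⟩
    have := Int.eq_zero_of_abs_lt_dvd hdvd (by rw [abs_lt]; constructor <;> omega)
    omega
  have hsq : (s : ℚ) = K * (A - C) + r₁ - r₂ := by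
    rw [hs]; push_cast; ring
  have hper : ∀ y : ℚ, g.eval (y + s) = g.eval y + D := by
    intro y
    have := hev ((y - r₂) / K - C)
    have e1 : (K : ℚ) * ((y - r₂) / K - C + A) + r₁ = y + s := by
      rw [hsq]; field_simp; ring
    have e2 : (K : ℚ) * (1 * ((y - r₂) / K - C) + C) + r₂ = y := by
      field_simp; ring
    rwa [e1, e2] at this
  have hm : ∀ m : ℕ, g.eval (s * m : ℚ) = g.eval 0 + m * D := by
    intro m
    induction m with
    | zero => simp
    | succ m ih =>
      have := hper (s * m)
      rw [ih] at this
      push_cast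
      rw [mul_add, mul_one, this]; ring
  have hlin : g.comp (Polynomial.C (s : ℚ) * X + Polynomial.C 0)
      = Polynomial.C (D : ℚ) * X + Polynomial.C (g.eval 0) := by
    apply Polynomial.eq_of_infinite_eval_eq
    apply (Set.infinite_range_of_injective (Nat.cast_injective (R := ℚ))).mono
    rintro _ ⟨m, rfl⟩
    simp only [Set.mem_ofPred_eq, eval_comp, eval_add, eval_mul, eval_C, eval_X, add_zero]
    rw [hm]; ring
  have hdeg := congrArg natDegree hlin
  rw [natDegree_comp, natDegree_linear (by exact_mod_cast hs0)] at hdeg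
  have := natDegree_linear_le (a := (D : ℚ)) (b := g.eval 0)
  omega
end
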